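/- Let d ≥ 5 and let u be a classical solution of the wave-Hartree equation on [a,b] × ℝ^d which is compactly supported in space on [a,b]. Define the Morawetz multiplier ψ(t,x) = (x/|x|)·∇u(t,x) + (d−1)u(t,x)/(2|x|) for x ≠ 0. Then the following Morawetz identity holds: ∫_a^b ∫_{ℝ^d} [ |∇_θu(t,x)|²/|x| + ((d−1)(d−3)/4)|u(t,x)|²/|x|³ ] dx dt + ∫_a^b ∬_{ℝ^d×ℝ^d} (|x||y| − ⟨x,y⟩)(1/|x| + 1/|y|) |x−y|⁻⁶ |u(t,x)|² |u(t,y)|² dy dx dt = ∫_{ℝ^d} ∂ₜu(a,x) ψ(a,x) dx − ∫_{ℝ^d} ∂ₜu(b,x) ψ(b,x) dx. -/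

import Mathlib

open MeasureTheory
open scoped ENNReal RealInnerProductSpace

noncomputable section

/-- Euclidean space `ℝ^d`. -/
abbrev Ed (d : ℕ) : Type := EuclideanSpace ℝ (Fin d)

/-- The time derivative `∂ₜ u (t,x)`. -/
def timeDeriv {d : ℕ} (u : ℝ → Ed d → ℝ) (t : ℝ) (x : Ed d) : ℝ :=
  deriv (fun s => u s x) t

/-- The spatial Laplacian `Δ f (x) = ∑ i ∂²f/∂xᵢ²`. -/
def spaceLaplacian {d : ℕ} (f : Ed d → ℝ) (x : Ed d) : ℝ :=
  ∑ i : Fin d, iteratedDeriv 2 (fun s : ℝ => f (x + s • EuclideanSpace.single i 1)) 0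

/-- The Hartree potential `(|·|⁻⁴ ∗ f²)(x) = ∫ f(y)² |x-y|⁻⁴ dy`. -/
def hartreePot {d : ℕ} (f : Ed d → ℝ) (x : Ed d) : ℝ :=
  ∫ y : Ed d, (f y) ^ 2 / ‖x - y‖ ^ 4

/-- `u` is a classical (C²) solution of the defocusing energy-critical wave-Hartree
equation `∂ₜₜu - Δu + (|·|⁻⁴ ∗ |u|²) u = 0` on the time interval `I`. -/
def IsWaveHartreeSol {d : ℕ} (I : Set ℝ) (u : ℝ → Ed d → ℝ) : Prop :=
  ContDiff ℝ 2 (fun p : ℝ × Ed d => u p.1 p.2) ∧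
  ∀ t ∈ I, ∀ x : Ed d,
    iteratedDeriv 2 (fun s => u s x) t - spaceLaplacian (u t) x
      + hartreePot (u t) x * u t x = 0

/-- The angular part of the gradient: `∇_θ f(x) = ∇f(x) - (x/|x|)⟨x/|x|, ∇f(x)⟩`. -/
def angularGrad {d : ℕ} (f : Ed d → ℝ) (x : Ed d) : Ed d :=
  gradient f x - ⟪‖x‖⁻¹ • x, gradient f x⟫ • (‖x‖⁻¹ • x)

/-- The Morawetz multiplier `ψ(t,x) = (x/|x|)·∇u(t,x) + (d-1)u(t,x)/(2|x|)`. -/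
def morawetzMult {d : ℕ} (u : ℝ → Ed d → ℝ) (t : ℝ) (x : Ed d) : ℝ :=
  ⟪‖x‖⁻¹ • x, gradient (u t) x⟫ + ((d : ℝ) - 1) * u t x / (2 * ‖x‖)

open Measure Module in
/-- The integral of an integrable line derivative vanishes, even if the function fails to be
differentiable at finitely many points, in dimension at least two. -/
lemma integral_hasLineDerivAt_eq_zero {E : Type*} [NormedAddCommGroup E] [NormedSpace ℝ E]
    [MeasurableSpace E] [BorelSpace E] [FiniteDimensional ℝ E] (hE : 2 ≤ finrank ℝ E)
    {μ : Measure E} [IsAddHaarMeasure μ] {S : Set E} (hS : S.Finite) {p p' : E → ℝ} {v : E}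
    (hv : v ≠ 0) (hp : Integrable p μ) (hp' : Integrable p' μ)
    (hd : ∀ x ∉ S, HasLineDerivAt ℝ p (p' x) x v) : ∫ x, p' x ∂μ = 0 := by
  let n := finrank ℝ E
  let E' := Fin (n - 1) → ℝ
  have hn : n - 1 ≠ 0 := by omega
  have : Nonempty (Fin (n - 1)) := ⟨⟨0, by omega⟩⟩
  obtain ⟨L, hL⟩ : ∃ L : E ≃L[ℝ] (E' × ℝ), L v = (0, 1) := by
    have : finrank ℝ (E' × ℝ) = n := by
      have : n - 1 + 1 = n := by omega
      simpa [E'] using this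
    have L₀ : E ≃L[ℝ] (E' × ℝ) := (ContinuousLinearEquiv.ofFinrankEq this).symm
    obtain ⟨M, hM⟩ : ∃ M : (E' × ℝ) ≃L[ℝ] (E' × ℝ), M (L₀ v) = (0, 1) := by
      apply SeparatingDual.exists_continuousLinearEquiv_apply_eq
      · simpa using hv
      · simp
    exact ⟨L₀.trans M, by simp [hM]⟩
  have hLs : L.symm (0, 1) = v := by rw [← hL]; simp
  let ν := Measure.map L μ
  have : IsAddHaarMeasure ν := L.isAddHaarMeasure_map μ
  have L_emb : MeasurableEmbedding L := L.toHomeomorph.measurableEmbedding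
  have hμ : μ = Measure.map L.symm ν := by
    simp [ν, Measure.map_map L.symm.continuous.measurable L.continuous.measurable]
  have hLc : Topology.IsClosedEmbedding L.symm := L.symm.toHomeomorph.isClosedEmbedding
  rw [hμ, hLc.integral_map]
  have A : ν = addHaarScalarFactor ν ((volume : Measure E').prod volume) •
      ((volume : Measure E').prod (volume : Measure ℝ)) :=
    isAddLeftInvariant_eq_smul _ _
  have A' : ((volume : Measure E').prod (volume : Measure ℝ)) =
      addHaarScalarFactor ((volume : Measure E').prod volume) ν • ν :=
    isAddLeftInvariant_eq_smul _ _
  have hq : Integrable (fun x => p (L.symm x)) ((volume : Measure E').prod volume) := by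
    rw [A']
    apply Integrable.smul_measure_nnreal
    simpa [ν, L_emb.integrable_map_iff, Function.comp_def] using hp
  have hq' : Integrable (fun x => p' (L.symm x)) ((volume : Measure E').prod volume) := by
    rw [A']
    apply Integrable.smul_measure_nnreal
    simpa [ν, L_emb.integrable_map_iff, Function.comp_def] using hp'
  rw [A, integral_smul_nnreal_measure, integral_prod _ hq']
  have : ∀ᵐ x : E', ∫ t : ℝ, p' (L.symm (x, t)) = 0 := by
    have hfin : ((fun s => (L s).1) '' S).Finite := hS.image _
    have hae : ∀ᵐ x : E', x ∉ (fun s => (L s).1) '' S :=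
      measure_eq_zero_iff_ae_notMem.1 (hfin.measure_zero volume)
    filter_upwards [hq.prod_right_ae, hq'.prod_right_ae, hae] with x h1 h2 h3
    refine integral_eq_zero_of_hasDerivAt_of_integrable (f := fun t => p (L.symm (x, t)))
      (fun t => ?_) h2 h1
    have hx : L.symm (x, t) ∉ S := fun h => h3 ⟨_, h, by simp⟩
    have h4 := hd _ hx
    unfold HasLineDerivAt at h4
    have h5 : HasDerivAt (fun s : ℝ => s - t) 1 t := (hasDerivAt_id t).sub_const t
    have h6 := HasDerivAt.comp t (h₂ := fun s : ℝ => p (L.symm (x, t) + s • v))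
      (by simpa using h4) h5
    convert! h6 using 1
    · ext s
      simp only [Function.comp, ← hLs, ← map_smul, ← map_add]
      simp
    · simp
  rw [integral_congr_ae this]
  simp

lemma integrableOn_inv_norm_pow {d k : ℕ} (hk : k < d) (r : ℝ) :
    IntegrableOn (fun x : Ed d => (‖x‖ ^ k)⁻¹) (Metric.ball 0 r) := by
  have : Nontrivial (Ed d) := by
    have : Nonempty (Fin d) := ⟨⟨0, by omega⟩⟩
    infer_instance
  rw [integrableOn_fun_norm_addHaar (μ := volume) (f := fun y : ℝ => (y ^ k)⁻¹)]
  have h1 : IntegrableOn (fun y : ℝ => y ^ (d - 1 - k)) (Set.Ioo 0 r) :=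
    (ContinuousOn.integrableOn_Icc (by fun_prop)).mono_set Set.Ioo_subset_Icc_self
  refine h1.congr_fun (fun y hy => ?_) measurableSet_Ioo
  have hy0 : y ≠ 0 := hy.1.ne'
  simp only [finrank_euclideanSpace, Fintype.card_fin, smul_eq_mul]
  have : d - 1 = (d - 1 - k) + k := by omega
  rw [this, pow_add]
  field_simp
  simp

/-- A bounded function supported in a ball times a function with an integrable singularity at
the origin is integrable. -/
lemma integrable_mul_of_le_inv_norm_pow {d k : ℕ} (hk : k < d) {G h : Ed d → ℝ} (hG : Continuous G)
    (hGs : HasCompactSupport G) (hh : Measurable h) {C : ℝ}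
    (hb : ∀ x, |h x| ≤ C * (‖x‖ ^ k)⁻¹) : Integrable (fun x => G x * h x) := by
  obtain ⟨M, hM⟩ := hGs.exists_bound_of_continuous hG
  obtain ⟨r, hr⟩ := hGs.isCompact.isBounded.subset_ball 0
  have h1 := ((integrableOn_inv_norm_pow hk r).integrable_indicator measurableSet_ball).const_mul
    (M * C)
  refine h1.mono' (hG.measurable.mul hh).aestronglyMeasurable (Filter.Eventually.of_forall ?_)
  intro x
  by_cases hx : x ∈ Metric.ball (0 : Ed d) r
  · rw [Set.indicator_of_mem hx, norm_mul, mul_assoc]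
    have := (norm_nonneg _).trans (hM x)
    gcongr
    · exact hM x
    · exact hb x
  · have : G x = 0 := image_eq_zero_of_notMem_tsupport fun h => hx (hr h)
    simp [Set.indicator_of_notMem hx, this]

/-- Integration by parts against a kernel which is singular at the origin. -/
lemma integral_fderiv_mul_add {d k : ℕ} (hd : 2 ≤ d) (hk : k + 1 < d) {G h h' : Ed d → ℝ}
    (hG : ContDiff ℝ 1 G) (hGs : HasCompactSupport G) (hh : Measurable h) (hh' : Measurable h')
    {C C' : ℝ} (hb : ∀ x, |h x| ≤ C * (‖x‖ ^ k)⁻¹) (hb' : ∀ x, |h' x| ≤ C' * (‖x‖ ^ (k + 1))⁻¹)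
    (i : Fin d) (hd' : ∀ x ≠ 0, HasLineDerivAt ℝ h (h' x) x (EuclideanSpace.single i 1)) :
    Integrable (fun x => fderiv ℝ G x (EuclideanSpace.single i 1) * h x) ∧
    Integrable (fun x => G x * h' x) ∧
    ∫ x, (fderiv ℝ G x (EuclideanSpace.single i 1) * h x + G x * h' x) = 0 := by
  have h1 : Integrable (fun x => fderiv ℝ G x (EuclideanSpace.single i 1) * h x) :=
    integrable_mul_of_le_inv_norm_pow (by omega)
      ((hG.continuous_fderiv one_ne_zero).clm_apply continuous_const)
      (hGs.fderiv_apply ℝ _) hh hb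
  have h2 : Integrable (fun x => G x * h' x) :=
    integrable_mul_of_le_inv_norm_pow hk hG.continuous hGs hh' hb'
  refine ⟨h1, h2, ?_⟩
  refine integral_hasLineDerivAt_eq_zero (S := {0}) (v := EuclideanSpace.single i 1)
    (p := fun x => G x * h x) (by simpa using hd)
    (Set.finite_singleton _) (by simp)
    (integrable_mul_of_le_inv_norm_pow (by omega) hG.continuous hGs hh hb) (h1.add h2) ?_
  intro x hx
  have h3 := ((hG.differentiable one_ne_zero) x).hasFDerivAt.hasLineDerivAt
    (EuclideanSpace.single i 1)
  have h4 := hd' x hx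
  unfold HasLineDerivAt at *
  convert! h3.mul h4 using 1
  simp

section kernels
variable {d : ℕ} {x : Ed d}

lemma abs_apply_le_norm (x : Ed d) (i : Fin d) : |x i| ≤ ‖x‖ := by
  simpa using PiLp.norm_apply_le x i

lemma sum_sq_apply (x : Ed d) : ∑ i, x i ^ 2 = ‖x‖ ^ 2 := by
  simp [EuclideanSpace.norm_sq_eq]

lemma hasLineDerivAt_norm (hx : x ≠ 0) (i : Fin d) :
    HasLineDerivAt ℝ (fun y : Ed d => ‖y‖) (x i / ‖x‖) x (EuclideanSpace.single i 1) := by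
  have h1 : HasLineDerivAt ℝ (fun y : Ed d => ‖y‖ ^ 2) (2 * x i) x
      (EuclideanSpace.single i 1) := by
    have := (hasStrictFDerivAt_norm_sq x).hasFDerivAt.hasLineDerivAt (EuclideanSpace.single i 1)
    simpa [real_inner_comm, EuclideanSpace.inner_single_left, EuclideanSpace.inner_single_right]
      using this
  unfold HasLineDerivAt at *
  have h2 := h1.sqrt (by simpa using hx)
  simp only [Real.sqrt_sq (norm_nonneg _)] at h2
  convert! h2 using 1
  simp
  field_simp

lemma hasLineDerivAt_apply (x : Ed d) (i j : Fin d) :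
    HasLineDerivAt ℝ (fun y : Ed d => y j) (if i = j then 1 else 0) x
      (EuclideanSpace.single i 1) := by
  have := (EuclideanSpace.proj j : Ed d →L[ℝ] ℝ).hasFDerivAt
    (x := x) |>.hasLineDerivAt (EuclideanSpace.single i 1)
  simpa [PiLp.single_apply, eq_comm] using this

lemma hasLineDerivAt_inv_norm (hx : x ≠ 0) (i : Fin d) :
    HasLineDerivAt ℝ (fun y : Ed d => ‖y‖⁻¹) (-(x i / ‖x‖ ^ 3)) x
      (EuclideanSpace.single i 1) := by
  have h1 := hasLineDerivAt_norm hx i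
  have h0 : ‖x‖ ≠ 0 := by simpa using hx
  unfold HasLineDerivAt at *
  convert! h1.inv (by simpa using hx) using 1
  simp
  field_simp

lemma hasLineDerivAt_apply_div_norm (hx : x ≠ 0) (i j : Fin d) :
    HasLineDerivAt ℝ (fun y : Ed d => y j / ‖y‖)
      ((if i = j then 1 else 0) / ‖x‖ - x i * x j / ‖x‖ ^ 3) x
      (EuclideanSpace.single i 1) := by
  have h1 := hasLineDerivAt_norm hx i
  have h2 := hasLineDerivAt_apply x i j
  have h0 : ‖x‖ ≠ 0 := by simpa using hx
  unfold HasLineDerivAt at *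
  convert! h2.div h1 (by simpa using hx) using 1
  split_ifs <;> simp <;> field_simp

lemma hasLineDerivAt_apply_div_norm_cube (hx : x ≠ 0) (i : Fin d) :
    HasLineDerivAt ℝ (fun y : Ed d => y i / ‖y‖ ^ 3)
      (1 / ‖x‖ ^ 3 - 3 * x i ^ 2 / ‖x‖ ^ 5) x (EuclideanSpace.single i 1) := by
  have h1 := (hasLineDerivAt_norm hx i)
  have h2 := hasLineDerivAt_apply x i i
  have h0 : ‖x‖ ≠ 0 := by simpa using hx
  unfold HasLineDerivAt at *
  convert! h2.div (h1.pow 3) (by simpa using hx) using 1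
  simp
  field_simp

lemma abs_apply_div_norm_le (x : Ed d) (i : Fin d) : |x i / ‖x‖| ≤ 1 := by
  rw [abs_div, abs_norm]
  exact div_le_one_of_le₀ (abs_apply_le_norm x i) (norm_nonneg _)

lemma abs_apply_mul_div_le (x : Ed d) (i j : Fin d) : |x i * x j / ‖x‖ ^ 3| ≤ ‖x‖⁻¹ := by
  rcases eq_or_ne x 0 with rfl | hx
  · simp
  have h0 : 0 < ‖x‖ := by simpa using hx
  have : x i * x j / ‖x‖ ^ 3 = (x i / ‖x‖) * (x j / ‖x‖) * ‖x‖⁻¹ := by field_simp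
  rw [this, abs_mul, abs_mul, abs_inv, abs_norm]
  have h1 := abs_apply_div_norm_le x i
  have h2 := abs_apply_div_norm_le x j
  have := mul_le_one₀ h1 (abs_nonneg _) h2
  have h3 : 0 ≤ ‖x‖⁻¹ := by positivity
  nlinarith

lemma abs_deriv_apply_div_norm_le (x : Ed d) (i j : Fin d) :
    |(if i = j then 1 else 0) / ‖x‖ - x i * x j / ‖x‖ ^ 3| ≤ 2 * ‖x‖⁻¹ := by
  have h1 := abs_apply_mul_div_le x i j
  have h2 : |(if i = j then (1 : ℝ) else 0) / ‖x‖| ≤ ‖x‖⁻¹ := by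
    split_ifs <;> simp
  exact (abs_sub _ _).trans (by linarith)

end kernels

/-- The `i`-th partial derivative of a function on `ℝ^d`. -/
def partialD {d : ℕ} (i : Fin d) (f : Ed d → ℝ) (x : Ed d) : ℝ :=
  fderiv ℝ f x (EuclideanSpace.single i 1)

section partialD
variable {d : ℕ} {f g : Ed d → ℝ} {i j : Fin d} {x : Ed d}

lemma ContDiff.partialD {n : WithTop ℕ∞} (hf : ContDiff ℝ (n + 1) f) (i : Fin d) :
    ContDiff ℝ n (partialD i f) :=
  (hf.fderiv_right le_rfl).clm_apply contDiff_const

lemma ContDiff.continuous_partialD (hf : ContDiff ℝ 1 f) (i : Fin d) :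
    Continuous (_root_.partialD i f) :=
  (hf.continuous_fderiv one_ne_zero).clm_apply continuous_const

lemma HasCompactSupport.partialD (hf : HasCompactSupport f) (i : Fin d) :
    HasCompactSupport (partialD i f) :=
  hf.fderiv_apply ℝ _

lemma partialD_mul (hf : DifferentiableAt ℝ f x) (hg : DifferentiableAt ℝ g x) :
    partialD i (fun y => f y * g y) x = partialD i f x * g x + f x * partialD i g x := by
  unfold partialD
  rw [fderiv_fun_mul hf hg]
  simp
  ring

lemma partialD_comm (hf : ContDiff ℝ 2 f) (x : Ed d) :
    partialD i (partialD j f) x = partialD j (partialD i f) x := by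
  have hd : DifferentiableAt ℝ (fderiv ℝ f) x :=
    (hf.fderiv_right (m := 1) (by norm_num)).differentiable one_ne_zero x
  have key : ∀ k l : Fin d, partialD k (partialD l f) x =
      fderiv ℝ (fderiv ℝ f) x (EuclideanSpace.single k 1) (EuclideanSpace.single l 1) := by
    intro k l
    unfold partialD
    rw [fderiv_clm_apply hd (differentiableAt_const _)]
    simp
  rw [key, key]
  have : IsSymmSndFDerivAt ℝ f x := hf.contDiffAt.isSymmSndFDerivAt (by simp)
  exact this.eq _ _

lemma hasLineDerivAt_partialD (hf : DifferentiableAt ℝ f x) (i : Fin d) :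
    HasLineDerivAt ℝ f (partialD i f x) x (EuclideanSpace.single i 1) :=
  hf.hasFDerivAt.hasLineDerivAt _

lemma fderiv_eq_sum_partialD (f : Ed d → ℝ) (x v : Ed d) :
    fderiv ℝ f x v = ∑ i, v i * partialD i f x := by
  conv_lhs => rw [← (EuclideanSpace.basisFun (Fin d) ℝ).sum_repr v]
  simp [partialD]

lemma inner_gradient_eq_sum (f : Ed d → ℝ) (x v : Ed d) :
    ⟪v, gradient f x⟫ = ∑ i, v i * partialD i f x := by
  rw [← fderiv_eq_sum_partialD, real_inner_comm]
  have := toDual_gradient (𝕜 := ℝ) (f := f) (x := x)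
  rw [← this]
  simp

lemma norm_gradient_sq (f : Ed d → ℝ) (x : Ed d) :
    ‖gradient f x‖ ^ 2 = ∑ i, partialD i f x ^ 2 := by
  rw [← sum_sq_apply]
  refine Finset.sum_congr rfl fun i _ => ?_
  have := inner_gradient_eq_sum f x (EuclideanSpace.single i 1)
  rw [EuclideanSpace.inner_single_left] at this
  simp only [map_one, one_mul, PiLp.single_apply, ite_mul, zero_mul, Finset.sum_ite_eq',
    Finset.mem_univ, if_true] at this
  rw [this]

lemma spaceLaplacian_eq (hf : ContDiff ℝ 2 f) (x : Ed d) :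
    spaceLaplacian f x = ∑ i, partialD i (partialD i f) x := by
  unfold spaceLaplacian
  refine Finset.sum_congr rfl fun i _ => ?_
  have key : ∀ g : Ed d → ℝ, Differentiable ℝ g →
      deriv (fun s : ℝ => g (x + s • EuclideanSpace.single i 1)) =
        fun s : ℝ => partialD i g (x + s • EuclideanSpace.single i 1) := by
    intro g hg
    ext s
    have h1 : HasDerivAt (fun s : ℝ => x + s • (EuclideanSpace.single i 1 : Ed d))
        (EuclideanSpace.single i 1) s := by
      simpa using ((hasDerivAt_id s).smul_const (EuclideanSpace.single i 1 : Ed d)).const_add x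
    exact ((hg _).hasFDerivAt.comp_hasDerivAt s h1).deriv
  rw [iteratedDeriv_succ, iteratedDeriv_one, key f (hf.differentiable two_ne_zero)]
  have h2 := key (partialD i f)
    ((hf.partialD (n := 1) i).differentiable one_ne_zero)
  rw [h2]
  simp

end partialD

section radial
variable {d : ℕ} {G : Ed d → ℝ}

lemma integral_partialD_mul_apply_div_norm (hd : 5 ≤ d) (hG : ContDiff ℝ 1 G)
    (hGs : HasCompactSupport G) (i j : Fin d) :
    Integrable (fun x => partialD i G x * (x j / ‖x‖) +
      G x * ((if i = j then 1 else 0) / ‖x‖ - x i * x j / ‖x‖ ^ 3)) ∧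
    ∫ x, (partialD i G x * (x j / ‖x‖) +
      G x * ((if i = j then 1 else 0) / ‖x‖ - x i * x j / ‖x‖ ^ 3)) = 0 := by
  have := integral_fderiv_mul_add (k := 0) (C := 1) (C' := 2) (by omega) (by omega) hG hGs
    (h := fun x => x j / ‖x‖)
    (h' := fun x => (if i = j then 1 else 0) / ‖x‖ - x i * x j / ‖x‖ ^ 3)
    (by fun_prop) (by fun_prop) (fun x => by simpa using abs_apply_div_norm_le x j)
    (fun x => by simpa using abs_deriv_apply_div_norm_le x i j) i
    (fun x hx => hasLineDerivAt_apply_div_norm hx i j)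
  exact ⟨this.1.add this.2.1, this.2.2⟩

lemma integral_partialD_mul_inv_norm (hd : 5 ≤ d) (hG : ContDiff ℝ 1 G)
    (hGs : HasCompactSupport G) (i : Fin d) :
    Integrable (fun x => partialD i G x * ‖x‖⁻¹ + G x * (-(x i / ‖x‖ ^ 3))) ∧
    ∫ x, (partialD i G x * ‖x‖⁻¹ + G x * (-(x i / ‖x‖ ^ 3))) = 0 := by
  have := integral_fderiv_mul_add (k := 1) (C := 1) (C' := 1) (by omega) (by omega) hG hGs
    (h := fun x => ‖x‖⁻¹) (h' := fun x => -(x i / ‖x‖ ^ 3))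
    (by fun_prop) (by fun_prop) (fun x => by simp)
    (fun x => by
      rcases eq_or_ne x 0 with rfl | hx
      · simp
      have h0 : 0 < ‖x‖ := by simpa using hx
      rw [abs_neg, abs_div, abs_pow, abs_norm, div_le_iff₀ (by positivity)]
      have : 1 * (‖x‖ ^ (1 + 1))⁻¹ * ‖x‖ ^ 3 = ‖x‖ := by field_simp
      rw [this]
      exact abs_apply_le_norm x i) i
    (fun x hx => hasLineDerivAt_inv_norm hx i)
  exact ⟨this.1.add this.2.1, this.2.2⟩

lemma integral_partialD_mul_apply_div_norm_cube (hd : 5 ≤ d) (hG : ContDiff ℝ 1 G)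
    (hGs : HasCompactSupport G) (i : Fin d) :
    Integrable (fun x => partialD i G x * (x i / ‖x‖ ^ 3) +
      G x * (1 / ‖x‖ ^ 3 - 3 * x i ^ 2 / ‖x‖ ^ 5)) ∧
    ∫ x, (partialD i G x * (x i / ‖x‖ ^ 3) +
      G x * (1 / ‖x‖ ^ 3 - 3 * x i ^ 2 / ‖x‖ ^ 5)) = 0 := by
  have := integral_fderiv_mul_add (k := 2) (C := 1) (C' := 4) (by omega) (by omega) hG hGs
    (h := fun x => x i / ‖x‖ ^ 3) (h' := fun x => 1 / ‖x‖ ^ 3 - 3 * x i ^ 2 / ‖x‖ ^ 5)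
    (by fun_prop) (by fun_prop) (fun x => by
      rcases eq_or_ne x 0 with rfl | hx
      · simp
      have h0 : 0 < ‖x‖ := by simpa using hx
      rw [abs_div, abs_pow, abs_norm, div_le_iff₀ (by positivity)]
      have := abs_apply_le_norm x i
      field_simp
      simpa using this)
    (fun x => by
      rcases eq_or_ne x 0 with rfl | hx
      · simp
      have h0 : 0 < ‖x‖ := by simpa using hx
      have : 1 / ‖x‖ ^ 3 - 3 * x i ^ 2 / ‖x‖ ^ 5 =
        (1 - 3 * (x i / ‖x‖) ^ 2) * (‖x‖ ^ 3)⁻¹ := by field_simp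
      rw [this, abs_mul, abs_inv, abs_pow, abs_norm]
      have h1 := (sq_le_one_iff_abs_le_one _).2 (abs_apply_div_norm_le x i)
      gcongr
      exact abs_le.2 ⟨by nlinarith, by nlinarith [sq_nonneg (x i / ‖x‖)]⟩) i
    (fun x hx => hasLineDerivAt_apply_div_norm_cube hx i)
  exact ⟨this.1.add this.2.1, this.2.2⟩

/-- The divergence theorem for the vector field `G(x) x / |x|`. -/
lemma integral_radial_div (hd : 5 ≤ d) (hG : ContDiff ℝ 1 G) (hGs : HasCompactSupport G) :
    ∫ x, (∑ i, partialD i G x * (x i / ‖x‖) + (d - 1) * G x / ‖x‖) = 0 := by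
  have h := fun i => integral_partialD_mul_apply_div_norm hd hG hGs i i
  have h2 := integral_finsetSum Finset.univ fun i _ => (h i).1
  rw [Finset.sum_eq_zero fun i _ => (h i).2] at h2
  rw [← h2]
  congr 1
  ext x
  rw [Finset.sum_add_distrib, ← Finset.mul_sum, Finset.sum_sub_distrib]
  rcases eq_or_ne x 0 with rfl | hx
  · simp
  have h0 : ‖x‖ ≠ 0 := by simpa using hx
  simp only [if_true, ← pow_two, ← Finset.sum_div, sum_sq_apply, Finset.sum_const,
    Finset.card_univ, Fintype.card_fin, nsmul_eq_mul]
  field_simp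

end radial

/-- The Morawetz multiplier of a function on `ℝ^d`, in coordinates. -/
def radialMult {d : ℕ} (f : Ed d → ℝ) (x : Ed d) : ℝ :=
  ∑ i, partialD i f x * (x i / ‖x‖) + ((d : ℝ) - 1) * f x / (2 * ‖x‖)

section identities
variable {d : ℕ} {f G : Ed d → ℝ}

lemma morawetzMult_eq (u : ℝ → Ed d → ℝ) (t : ℝ) (x : Ed d) :
    morawetzMult u t x = radialMult (u t) x := by
  unfold morawetzMult radialMult
  rw [inner_gradient_eq_sum]
  congr 1
  refine Finset.sum_congr rfl fun i _ => ?_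
  simp
  ring

lemma integrable_mul_radial (hd : 5 ≤ d) (hG : Continuous G) (hf : ContDiff ℝ 1 f)
    (hfs : HasCompactSupport f) (c : ℝ) :
    Integrable (fun x => G x * (∑ i, partialD i f x * (x i / ‖x‖) + c * f x / ‖x‖)) := by
  have h1 : ∀ i, Integrable (fun x => (G x * partialD i f x) * (x i / ‖x‖)) := fun i =>
    integrable_mul_of_le_inv_norm_pow (k := 0) (C := 1) (by omega)
      (hG.mul (hf.continuous_partialD i)) (hfs.partialD i).mul_left (by fun_prop)
      (fun x => by simpa using abs_apply_div_norm_le x i)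
  have h2 : Integrable (fun x => (G x * f x) * ‖x‖⁻¹) :=
    integrable_mul_of_le_inv_norm_pow (k := 1) (C := 1) (by omega)
      (hG.mul hf.continuous) hfs.mul_left (by fun_prop) (fun x => by simp)
  refine ((integrable_finsetSum Finset.univ fun i _ => h1 i).add
    (h2.const_mul c)).congr (Filter.Eventually.of_forall fun x => ?_)
  simp only [Pi.add_apply, mul_add, Finset.mul_sum]
  congr 1
  · exact Finset.sum_congr rfl fun i _ => by ring
  · ring

lemma integrable_mul_radialMult (hd : 5 ≤ d) (hG : Continuous G) (hf : ContDiff ℝ 1 f)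
    (hfs : HasCompactSupport f) : Integrable (fun x => G x * radialMult f x) := by
  refine (integrable_mul_radial hd hG hf hfs (((d : ℝ) - 1) / 2)).congr
    (Filter.Eventually.of_forall fun x => ?_)
  simp only [radialMult]
  ring

/-- The momentum density of a single function integrates to zero. -/
lemma integral_mul_radialMult_self (hd : 5 ≤ d) (hf : ContDiff ℝ 1 f)
    (hfs : HasCompactSupport f) : ∫ x, f x * radialMult f x = 0 := by
  have h := integral_radial_div hd (hf.mul hf) (hfs.mul_left (f := f))
  have : ∀ x, f x * radialMult f x = 2⁻¹ * (∑ i, partialD i (fun y => f y * f y) x * (x i / ‖x‖)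
      + (d - 1) * (f x * f x) / ‖x‖) := by
    intro x
    have hx := hf.differentiable one_ne_zero x
    simp only [partialD_mul hx hx, radialMult, mul_add, Finset.mul_sum]
    congr 1
    · exact Finset.sum_congr rfl fun i _ => by ring
    · ring
  simp only [this]
  rw [integral_const_mul, h, mul_zero]

lemma sq_norm_angularGrad {x : Ed d} (hx : x ≠ 0) (f : Ed d → ℝ) :
    ‖angularGrad f x‖ ^ 2 =
      ∑ i, partialD i f x ^ 2 - (∑ i, partialD i f x * (x i / ‖x‖)) ^ 2 := by
  have h0 : ‖x‖ ≠ 0 := by simpa using hx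
  have h1 : ⟪‖x‖⁻¹ • x, gradient f x⟫ = ∑ i, partialD i f x * (x i / ‖x‖) := by
    rw [inner_gradient_eq_sum]
    exact Finset.sum_congr rfl fun i _ => by simp; ring
  unfold angularGrad
  rw [norm_sub_sq_real, norm_gradient_sq, inner_smul_right,
    real_inner_comm (‖x‖⁻¹ • x), h1, norm_smul,
    norm_smul, norm_inv, norm_norm, inv_mul_cancel₀ h0, mul_one, Real.norm_eq_abs, sq_abs]
  ring

lemma laplacian_radialMult_algebra {r F : ℝ} (hr : r ≠ 0) (x g : Fin d → ℝ)
    (H : Fin d → Fin d → ℝ) (hH : ∀ i j, H i j = H j i) (hx : ∑ i, x i ^ 2 = r ^ 2) :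
    (∑ i, ∑ j, (((H i i * g j + g i * H i j) * (x j / r) +
          g i * g j * ((if i = j then 1 else 0) / r - x i * x j / r ^ 3)) -
        2⁻¹ * ((H j i * g i + g i * H j i) * (x j / r) +
          g i * g i * ((if j = j then 1 else 0) / r - x j * x j / r ^ 3)))) +
      (d - 1) / 2 * ∑ i, (((g i * g i + F * H i i) * r⁻¹ + F * g i * (-(x i / r ^ 3))) +
        2⁻¹ * ((g i * F + F * g i) * (x i / r ^ 3) +
          F * F * (1 / r ^ 3 - 3 * x i ^ 2 / r ^ 5))) =
    (∑ i, H i i) * (∑ i, g i * (x i / r) + (d - 1) * F / (2 * r)) +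
      ((∑ i, g i ^ 2 - (∑ i, g i * (x i / r)) ^ 2) / r + ((d - 1) * (d - 3) / 4) * F ^ 2 / r ^ 3)
      := by
  have e1 : ∀ i, ∑ j, (((H i i * g j + g i * H i j) * (x j / r) +
          g i * g j * ((if i = j then 1 else 0) / r - x i * x j / r ^ 3)) -
        2⁻¹ * ((H j i * g i + g i * H j i) * (x j / r) +
          g i * g i * ((if j = j then 1 else 0) / r - x j * x j / r ^ 3))) =
      H i i * (∑ j, g j * x j) / r + g i ^ 2 / r - g i * x i * (∑ j, g j * x j) / r ^ 3 -
        2⁻¹ * g i ^ 2 * (d - 1) / r := by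
    intro i
    have : ∀ j, (((H i i * g j + g i * H i j) * (x j / r) +
          g i * g j * ((if i = j then 1 else 0) / r - x i * x j / r ^ 3)) -
        2⁻¹ * ((H j i * g i + g i * H j i) * (x j / r) +
          g i * g i * ((if j = j then 1 else 0) / r - x j * x j / r ^ 3))) =
        (H i i / r) * (g j * x j) + (if i = j then g i * g j / r else 0)
          - (g i * x i / r ^ 3) * (g j * x j) - 2⁻¹ * g i ^ 2 / r
          + (2⁻¹ * g i ^ 2 / r ^ 3) * x j ^ 2 := by
      intro j
      rw [hH j i, if_pos (rfl : j = j)]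
      split_ifs with h
      · subst h; ring
      · ring
    rw [Finset.sum_congr rfl fun j _ => this j]
    simp only [Finset.sum_add_distrib, Finset.sum_sub_distrib, ← Finset.mul_sum, hx,
      Finset.sum_ite_eq, Finset.mem_univ, if_true, Finset.sum_const, Finset.card_univ,
      Fintype.card_fin, nsmul_eq_mul]
    field_simp
    ring
  have e2 : ∀ i, (((g i * g i + F * H i i) * r⁻¹ + F * g i * (-(x i / r ^ 3))) +
        2⁻¹ * ((g i * F + F * g i) * (x i / r ^ 3) +
          F * F * (1 / r ^ 3 - 3 * x i ^ 2 / r ^ 5))) =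
      r⁻¹ * g i ^ 2 + (F / r) * H i i + 2⁻¹ * F ^ 2 / r ^ 3
        - (2⁻¹ * F ^ 2 * 3 / r ^ 5) * x i ^ 2 := by
    intro i
    ring
  have e3 : ∑ i, g i * (x i / r) = (∑ i, g i * x i) / r := by
    rw [Finset.sum_div]
    exact Finset.sum_congr rfl fun i _ => by ring
  have e4 : ∀ i, H i i * (∑ j, g j * x j) / r + g i ^ 2 / r - g i * x i * (∑ j, g j * x j) / r ^ 3 -
        2⁻¹ * g i ^ 2 * (d - 1) / r = ((∑ j, g j * x j) / r) * H i i + r⁻¹ * g i ^ 2 -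
      ((∑ j, g j * x j) / r ^ 3) * (g i * x i) - (2⁻¹ * (d - 1) / r) * g i ^ 2 := by
    intro i
    ring
  rw [Finset.sum_congr rfl fun i _ => (e1 i).trans (e4 i), Finset.sum_congr rfl fun i _ => e2 i, e3]
  simp only [Finset.sum_add_distrib, Finset.sum_sub_distrib, ← Finset.mul_sum, hx,
      Finset.sum_const, Finset.card_univ,
      Fintype.card_fin, nsmul_eq_mul]
  field_simp
  ring

/-- The Morawetz identity for the Laplacian. -/
lemma integral_laplacian_mul_radialMult (hd : 5 ≤ d) (hf : ContDiff ℝ 2 f)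
    (hfs : HasCompactSupport f) :
    Integrable (fun x => ‖angularGrad f x‖ ^ 2 / ‖x‖
      + (((d : ℝ) - 1) * ((d : ℝ) - 3) / 4) * f x ^ 2 / ‖x‖ ^ 3) ∧
    ∫ x, (∑ i, partialD i (partialD i f) x) * radialMult f x =
      - ∫ x, (‖angularGrad f x‖ ^ 2 / ‖x‖
      + (((d : ℝ) - 1) * ((d : ℝ) - 3) / 4) * f x ^ 2 / ‖x‖ ^ 3) := by
  have hf1 : ContDiff ℝ 1 f := hf.of_le one_le_two
  have hpd : ∀ i, ContDiff ℝ 1 (partialD i f) := fun i => hf.partialD (n := 1) i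
  have hA := fun i j => integral_partialD_mul_apply_div_norm hd ((hpd i).mul (hpd j))
    ((hfs.partialD j).mul_left (f := partialD i f)) i j
  have hB := fun i j => integral_partialD_mul_apply_div_norm hd ((hpd i).mul (hpd i))
    ((hfs.partialD i).mul_left (f := partialD i f)) j j
  have hC := fun i => integral_partialD_mul_inv_norm hd (hf1.mul (hpd i))
    ((hfs.partialD i).mul_left (f := f)) i
  have hD := fun i => integral_partialD_mul_apply_div_norm_cube hd (hf1.mul hf1)
    (hfs.mul_left (f := f)) i
  have i1 := fun i j => (hA i j).1.sub ((hB i j).1.const_mul 2⁻¹)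
  have i2 := integrable_finsetSum Finset.univ fun i _ => integrable_finsetSum Finset.univ
    fun j _ => i1 i j
  have i3 := fun i => (hC i).1.add ((hD i).1.const_mul 2⁻¹)
  have i4 := (integrable_finsetSum Finset.univ fun i _ => i3 i).const_mul (((d : ℝ) - 1) / 2)
  obtain ⟨W, hW⟩ : ∃ W : Ed d → ℝ, W = fun x =>
      (∑ i, ∑ j, ((partialD i (fun y => partialD i f y * partialD j f y) x * (x j / ‖x‖) +
          partialD i f x * partialD j f x *
            ((if i = j then 1 else 0) / ‖x‖ - x i * x j / ‖x‖ ^ 3)) -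
        2⁻¹ * (partialD j (fun y => partialD i f y * partialD i f y) x * (x j / ‖x‖) +
          partialD i f x * partialD i f x *
            ((if j = j then 1 else 0) / ‖x‖ - x j * x j / ‖x‖ ^ 3)))) +
      ((d : ℝ) - 1) / 2 * ∑ i, ((partialD i (fun y => f y * partialD i f y) x * ‖x‖⁻¹ +
          f x * partialD i f x * (-(x i / ‖x‖ ^ 3))) +
        2⁻¹ * (partialD i (fun y => f y * f y) x * (x i / ‖x‖ ^ 3) +
          f x * f x * (1 / ‖x‖ ^ 3 - 3 * x i ^ 2 / ‖x‖ ^ 5))) := ⟨_, rfl⟩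
  have z : ∫ x, W x = 0 := by
    rw [hW]
    refine (integral_add i2 i4).trans ?_
    rw [integral_const_mul, integral_finsetSum _ fun i _ => i3 i,
      integral_finsetSum _ fun i _ => integrable_finsetSum Finset.univ fun j _ => i1 i j]
    rw [Finset.sum_eq_zero, Finset.sum_eq_zero]
    · simp
    · intro i _
      refine (integral_add (hC i).1 ((hD i).1.const_mul _)).trans ?_
      rw [integral_const_mul, (hC i).2, (hD i).2]
      simp
    · intro i _
      rw [integral_finsetSum _ fun j _ => i1 i j]
      refine Finset.sum_eq_zero fun j _ => ?_
      refine (integral_sub (hA i j).1 ((hB i j).1.const_mul _)).trans ?_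
      rw [integral_const_mul, (hA i j).2, (hB i j).2]
      simp
  have i5 : Integrable W := by
    rw [hW]
    exact i2.add i4
  have hnt : Nontrivial (Ed d) := by
    have : Nonempty (Fin d) := ⟨⟨0, by omega⟩⟩
    infer_instance
  have hae : ∀ᵐ x : Ed d, x ≠ 0 := by simp [ae_iff]
  have i6 : Integrable fun x => (∑ i, partialD i (partialD i f) x) * radialMult f x :=
    integrable_mul_radialMult hd
      (continuous_finsetSum _ fun i _ => (hpd i).continuous_partialD i) hf1 hfs
  have key : ∀ᵐ x : Ed d, W x =
      (∑ i, partialD i (partialD i f) x) * radialMult f x + (‖angularGrad f x‖ ^ 2 / ‖x‖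
      + (((d : ℝ) - 1) * ((d : ℝ) - 3) / 4) * f x ^ 2 / ‖x‖ ^ 3) := by
    filter_upwards [hae] with x hx
    have h0 : ‖x‖ ≠ 0 := by simpa using hx
    have d0 := hf1.differentiable one_ne_zero x
    have d1 := fun i => (hpd i).differentiable one_ne_zero x
    have alg := laplacian_radialMult_algebra (F := f x) h0 x.ofLp (fun i => partialD i f x)
      (fun i j => partialD i (partialD j f) x) (fun i j => partialD_comm hf x) (sum_sq_apply x)
    simp only [if_true] at alg
    simp only [hW, partialD_mul d0 d0, partialD_mul d0 (d1 _), partialD_mul (d1 _) (d1 _), if_true]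
    rw [alg, sq_norm_angularGrad hx, radialMult]
  have i7 : Integrable fun x => ‖angularGrad f x‖ ^ 2 / ‖x‖
      + (((d : ℝ) - 1) * ((d : ℝ) - 3) / 4) * f x ^ 2 / ‖x‖ ^ 3 := by
    refine (i5.sub i6).congr ?_
    filter_upwards [key] with x hx
    have : ∀ a b c : ℝ, a = b + c → a - b = c := fun a b c h => by linarith
    exact this _ _ _ hx
  refine ⟨i7, ?_⟩
  rw [eq_neg_iff_add_eq_zero, ← integral_add i6 i7, ← z]
  exact integral_congr_ae (by filter_upwards [key] with x hx using hx.symm)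

end identities

section hartree
variable {d : ℕ} {F G : Ed d → ℝ}

lemma locallyIntegrable_inv_norm_pow_four (hd : 5 ≤ d) :
    LocallyIntegrable (fun z : Ed d => (‖z‖ ^ 4)⁻¹) := by
  rw [locallyIntegrable_iff]
  intro k hk
  obtain ⟨r, hr⟩ := hk.isBounded.subset_ball 0
  exact (integrableOn_inv_norm_pow (by omega) r).mono_set hr

lemma integrable_mul_of_le_inv_norm_sub_pow_four (hd : 5 ≤ d) (hG : Continuous G)
    (hGs : HasCompactSupport G) {h : Ed d → ℝ} (hh : Measurable h) (x : Ed d) {C : ℝ}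
    (hb : ∀ y, |h y| ≤ C * (‖x - y‖ ^ 4)⁻¹) : Integrable (fun y => G y * h y) := by
  have h1 := (hGs.convolutionExists_right (ContinuousLinearMap.mul ℝ ℝ)
    (locallyIntegrable_inv_norm_pow_four hd) hG x).integrable_swap
  refine (h1.norm.const_mul C).mono' (hG.measurable.mul hh).aestronglyMeasurable
    (Filter.Eventually.of_forall fun y => ?_)
  simp only [ContinuousLinearMap.mul_apply', norm_mul, norm_inv, norm_pow, norm_norm]
  calc ‖G y‖ * ‖h y‖ ≤ ‖G y‖ * (C * (‖x - y‖ ^ 4)⁻¹) := by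
        gcongr
        exact hb y
    _ = _ := by ring

lemma integrable_div_norm_sub_pow_four (hd : 5 ≤ d) (hG : Continuous G)
    (hGs : HasCompactSupport G) (x : Ed d) : Integrable (fun y => G y / ‖x - y‖ ^ 4) := by
  simp only [div_eq_mul_inv]
  exact integrable_mul_of_le_inv_norm_sub_pow_four hd hG hGs (by fun_prop) x (C := 1)
    (fun y => by simp)

lemma contDiff_potential (hd : 5 ≤ d) (hF : ContDiff ℝ 1 F) (hFs : HasCompactSupport F) :
    ContDiff ℝ 1 (fun x => ∫ y, F y / ‖x - y‖ ^ 4) ∧ ∀ i x,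
      partialD i (fun x => ∫ y, F y / ‖x - y‖ ^ 4) x = ∫ y, partialD i F y / ‖x - y‖ ^ 4 := by
  have hK := locallyIntegrable_inv_norm_pow_four hd
  have hconv : ∀ g : Ed d → ℝ, (fun x => ∫ y, g y / ‖x - y‖ ^ 4) =
      convolution (fun z : Ed d => (‖z‖ ^ 4)⁻¹) g (ContinuousLinearMap.mul ℝ ℝ) volume := by
    intro g
    ext x
    rw [convolution_mul_swap]
    congr 1
    ext y
    ring
  refine ⟨?_, fun i x => ?_⟩
  · rw [hconv]
    exact_mod_cast hFs.contDiff_convolution_right (n := 1) _ hK hF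
  · rw [hconv, partialD, (hFs.hasFDerivAt_convolution_right _ hK hF x).fderiv,
      convolution_precompR_apply _ hK (hFs.fderiv ℝ) (hF.continuous_fderiv one_ne_zero)]
    exact (congrFun (hconv (partialD i F)) x).symm

lemma integrable_prod_potential (hd : 5 ≤ d) (hF : Continuous F) (hFs : HasCompactSupport F)
    {m : Ed d → ℝ} (hm : Integrable m) (hms : HasCompactSupport m) :
    Integrable (fun p : Ed d × Ed d => F p.1 * m p.2 / ‖p.1 - p.2‖ ^ 4)
      (volume.prod volume) := by
  obtain ⟨M, hM⟩ := hFs.exists_bound_of_continuous hF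
  obtain ⟨r, hr⟩ := hFs.isCompact.isBounded.subset_ball 0
  obtain ⟨s, hs⟩ := hms.isCompact.isBounded.subset_ball 0
  have hg := (integrableOn_inv_norm_pow (k := 4) (by omega : 4 < d) (r + s)).integrable_indicator
    measurableSet_ball
  have h1 := hm.convolution_integrand (ContinuousLinearMap.mul ℝ ℝ) hg
  have h2 := h1.bdd_mul (f := fun p : Ed d × Ed d => F p.1) (c := M)
    (hF.comp continuous_fst).aestronglyMeasurable (Filter.Eventually.of_forall fun p => hM p.1)
  refine h2.congr (Filter.Eventually.of_forall fun p => ?_)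
  simp only [ContinuousLinearMap.mul_apply']
  by_cases hp1 : F p.1 = 0
  · simp [hp1]
  by_cases hp2 : m p.2 = 0
  · simp [hp2]
  have a1 := hr (subset_tsupport F hp1)
  have a2 := hs (subset_tsupport m hp2)
  have : p.1 - p.2 ∈ Metric.ball (0 : Ed d) (r + s) := by
    simp only [mem_ball_zero_iff] at *
    exact (norm_sub_le _ _).trans_lt (add_lt_add a1 a2)
  rw [Set.indicator_of_mem this]
  ring

lemma norm_normalize_sub_le {x : Ed d} (hx : x ≠ 0) (y : Ed d) (i : Fin d) :
    |y i / ‖y‖ - x i / ‖x‖| ≤ 2 * ‖x - y‖ / ‖x‖ := by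
  have h0 : 0 < ‖x‖ := by simpa using hx
  rcases eq_or_ne y 0 with rfl | hy
  · have := abs_apply_div_norm_le x i
    rw [sub_zero, mul_div_assoc, div_self h0.ne']
    simp only [PiLp.zero_apply, zero_div, zero_sub, abs_neg]
    linarith
  have h1 : 0 < ‖y‖ := by simpa using hy
  have e : y i / ‖y‖ - x i / ‖x‖ = (y i / ‖y‖ * (‖x‖ - ‖y‖) - (x - y) i) / ‖x‖ := by
    simp only [PiLp.sub_apply]
    field_simp
    ring
  rw [e, abs_div, abs_norm]
  gcongr
  have h2 := abs_apply_div_norm_le y i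
  have h3 := abs_norm_sub_norm_le x y
  have h4 := abs_apply_le_norm (x - y) i
  calc _ ≤ |y i / ‖y‖ * (‖x‖ - ‖y‖)| + |(x - y) i| := abs_sub _ _
    _ ≤ 1 * ‖x - y‖ + ‖x - y‖ := by
      rw [abs_mul]
      gcongr
    _ = _ := by ring

lemma hasLineDerivAt_inv_norm_sub_pow_four {x y : Ed d} (hxy : y ≠ x) (i : Fin d) :
    HasLineDerivAt ℝ (fun y : Ed d => (‖x - y‖ ^ 4)⁻¹) (4 * (x i - y i) / ‖x - y‖ ^ 6) y
      (EuclideanSpace.single i 1) := by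
  have h0 : ‖y - x‖ ≠ 0 := by simpa [sub_eq_zero] using hxy
  have h1 := hasLineDerivAt_norm (sub_ne_zero.2 hxy) i
  unfold HasLineDerivAt at *
  have h2 := (h1.pow 4).inv (by simpa [sub_eq_zero] using hxy)
  convert! h2 using 1
  · ext t
    simp only [Pi.inv_apply, Pi.pow_apply]
    rw [norm_sub_rev]
    congr 3
    abel
  · rw [norm_sub_rev]
    simp
    field_simp
    ring

/-- For fixed `x`, integration by parts in `y` against the kernel
`|x - y|⁻⁴ (y / |y| - x / |x|)`. -/
lemma integral_radial_potential_sub (hd : 5 ≤ d) (hF : ContDiff ℝ 1 F) (hFs : HasCompactSupport F)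
    {x : Ed d} (hx : x ≠ 0) (hFx : Integrable (fun y => F y * ‖y‖⁻¹ / ‖x - y‖ ^ 4)) :
    (∫ y, (∑ i, partialD i F y * (y i / ‖y‖) + (d - 1) * F y / ‖y‖) / ‖x - y‖ ^ 4) -
      ∑ i, (x i / ‖x‖) * ∫ y, partialD i F y / ‖x - y‖ ^ 4 =
    4 * ∫ y, (∑ i, (x i - y i) * (x i / ‖x‖ - y i / ‖y‖)) / ‖x - y‖ ^ 6 * F y := by
  have hX : ∀ i (y : Ed d), |y i / ‖y‖ - x i / ‖x‖| ≤ 2 := fun i y =>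
    (abs_sub _ _).trans (by linarith [abs_apply_div_norm_le x i, abs_apply_div_norm_le y i])
  have b1 : ∀ i (y : Ed d), |(‖x - y‖ ^ 4)⁻¹ * (y i / ‖y‖ - x i / ‖x‖)| ≤
      2 * (‖x - y‖ ^ 4)⁻¹ := by
    intro i y
    rw [abs_mul, abs_of_nonneg (by positivity : 0 ≤ (‖x - y‖ ^ 4)⁻¹), mul_comm]
    gcongr
    exact hX i y
  have b3 : ∀ i (y : Ed d), |4 * (x i - y i) / ‖x - y‖ ^ 6 * (y i / ‖y‖ - x i / ‖x‖)| ≤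
      (8 / ‖x‖) * (‖x - y‖ ^ 4)⁻¹ := by
    intro i y
    rcases eq_or_ne y x with rfl | hxy
    · simp
    have h0 : 0 < ‖x - y‖ := by simpa [sub_eq_zero, eq_comm] using hxy
    rw [abs_mul, abs_div, abs_mul, abs_pow, abs_norm]
    have h1 := abs_apply_le_norm (x - y) i
    have h2 := norm_normalize_sub_le hx y i
    calc _ ≤ |4| * ‖x - y‖ / ‖x - y‖ ^ 6 * (2 * ‖x - y‖ / ‖x‖) := by
          gcongr
          exact h1
      _ = _ := by
        rw [abs_of_nonneg (by norm_num : (0 : ℝ) ≤ 4)]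
        field_simp
        norm_num
  have ip : ∀ i, Integrable (fun y => F y * ((‖x - y‖ ^ 4)⁻¹ * (y i / ‖y‖ - x i / ‖x‖))) :=
    fun i => integrable_mul_of_le_inv_norm_sub_pow_four hd hF.continuous hFs (by fun_prop) x (b1 i)
  have i1 : ∀ i, Integrable (fun y => partialD i F y *
      ((‖x - y‖ ^ 4)⁻¹ * (y i / ‖y‖ - x i / ‖x‖))) :=
    fun i => integrable_mul_of_le_inv_norm_sub_pow_four hd (hF.continuous_partialD i)
      (hFs.partialD i) (by fun_prop) x (b1 i)
  have i2 : ∀ i, Integrable (fun y => F y *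
      ((‖x - y‖ ^ 4)⁻¹ * (1 / ‖y‖ - y i * y i / ‖y‖ ^ 3))) := by
    intro i
    refine (hFx.norm.const_mul 2).mono' (by have := hF.continuous; fun_prop)
      (Filter.Eventually.of_forall fun y => ?_)
    have := abs_deriv_apply_div_norm_le y i i
    rw [if_pos rfl] at this
    simp only [norm_mul, norm_div, norm_inv, norm_pow, Real.norm_eq_abs] at *
    simp only [← Real.norm_eq_abs, norm_norm] at *
    calc _ ≤ ‖F y‖ * ((‖x - y‖ ^ 4)⁻¹ * (2 * ‖y‖⁻¹)) := by gcongr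
      _ = _ := by ring
  have i3 : ∀ i, Integrable (fun y => F y *
      (4 * (x i - y i) / ‖x - y‖ ^ 6 * (y i / ‖y‖ - x i / ‖x‖))) :=
    fun i => integrable_mul_of_le_inv_norm_sub_pow_four hd hF.continuous hFs (by fun_prop) x (b3 i)
  have i4 : ∀ i, Integrable (fun y => partialD i F y / ‖x - y‖ ^ 4) := fun i =>
    integrable_div_norm_sub_pow_four hd (hF.continuous_partialD i) (hFs.partialD i) x
  have iw : ∀ i, Integrable (fun y =>
      partialD i F y * ((‖x - y‖ ^ 4)⁻¹ * (y i / ‖y‖ - x i / ‖x‖)) +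
      F y * ((‖x - y‖ ^ 4)⁻¹ * (1 / ‖y‖ - y i * y i / ‖y‖ ^ 3)) +
      F y * (4 * (x i - y i) / ‖x - y‖ ^ 6 * (y i / ‖y‖ - x i / ‖x‖))) :=
    fun i => ((i1 i).add (i2 i)).add (i3 i)
  have z : ∀ i, ∫ y, (partialD i F y * ((‖x - y‖ ^ 4)⁻¹ * (y i / ‖y‖ - x i / ‖x‖)) +
      F y * ((‖x - y‖ ^ 4)⁻¹ * (1 / ‖y‖ - y i * y i / ‖y‖ ^ 3)) +
      F y * (4 * (x i - y i) / ‖x - y‖ ^ 6 * (y i / ‖y‖ - x i / ‖x‖))) = 0 := by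
    intro i
    refine integral_hasLineDerivAt_eq_zero (S := {0, x}) (v := EuclideanSpace.single i 1)
      (by simp; omega) (Set.toFinite _) (by simp) (ip i) (iw i) ?_
    intro y hy
    simp only [Set.mem_insert_iff, Set.mem_singleton_iff, not_or] at hy
    have h1 := hasLineDerivAt_partialD (hF.differentiable one_ne_zero y) i
    have h2 := hasLineDerivAt_inv_norm_sub_pow_four hy.2 i
    have h3 := hasLineDerivAt_apply_div_norm hy.1 i i
    unfold HasLineDerivAt at *
    convert! h1.mul (h2.mul (h3.sub_const (x i / ‖x‖))) using 1
    simp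
    ring
  have hz : ∫ y, ∑ i, (partialD i F y * ((‖x - y‖ ^ 4)⁻¹ * (y i / ‖y‖ - x i / ‖x‖)) +
      F y * ((‖x - y‖ ^ 4)⁻¹ * (1 / ‖y‖ - y i * y i / ‖y‖ ^ 3)) +
      F y * (4 * (x i - y i) / ‖x - y‖ ^ 6 * (y i / ‖y‖ - x i / ‖x‖))) = 0 := by
    rw [integral_finsetSum _ fun i _ => iw i]
    exact Finset.sum_eq_zero fun i _ => z i
  have i5 := integrable_finsetSum Finset.univ fun i _ => (i4 i).const_mul (x i / ‖x‖)
  have i6 : Integrable (fun y => (∑ i, (x i - y i) * (x i / ‖x‖ - y i / ‖y‖)) /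
      ‖x - y‖ ^ 6 * F y) := by
    refine ((integrable_finsetSum Finset.univ fun i _ => i3 i).const_mul (-4⁻¹)).congr
      (Filter.Eventually.of_forall fun y => ?_)
    simp only [Finset.mul_sum, Finset.sum_div, Finset.sum_mul]
    exact Finset.sum_congr rfl fun i _ => by ring
  have i7 := integrable_finsetSum Finset.univ fun i _ => iw i
  have key : ∀ y, (∑ i, partialD i F y * (y i / ‖y‖) + (d - 1) * F y / ‖y‖) / ‖x - y‖ ^ 4 =
      (∑ i, (partialD i F y * ((‖x - y‖ ^ 4)⁻¹ * (y i / ‖y‖ - x i / ‖x‖)) +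
      F y * ((‖x - y‖ ^ 4)⁻¹ * (1 / ‖y‖ - y i * y i / ‖y‖ ^ 3)) +
      F y * (4 * (x i - y i) / ‖x - y‖ ^ 6 * (y i / ‖y‖ - x i / ‖x‖)))) +
      (∑ i, (x i / ‖x‖) * (partialD i F y / ‖x - y‖ ^ 4) +
      4 * ((∑ i, (x i - y i) * (x i / ‖x‖ - y i / ‖y‖)) / ‖x - y‖ ^ 6 * F y)) := by
    intro y
    have e1 : ((d : ℝ) - 1) / ‖y‖ = ∑ i, (1 / ‖y‖ - y i * y i / ‖y‖ ^ 3) := by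
      rw [Finset.sum_sub_distrib]
      rcases eq_or_ne y 0 with rfl | hy
      · simp
      have h0 : ‖y‖ ≠ 0 := by simpa using hy
      simp only [← pow_two, ← Finset.sum_div, sum_sq_apply, Finset.sum_const,
        Finset.card_univ, Fintype.card_fin, nsmul_eq_mul]
      field_simp
    have e2 : ((d : ℝ) - 1) * F y / ‖y‖ = F y * ∑ i, (1 / ‖y‖ - y i * y i / ‖y‖ ^ 3) := by
      rw [← e1]
      ring
    rw [e2]
    simp only [Finset.mul_sum, Finset.sum_div, Finset.sum_mul, add_div, ← Finset.sum_add_distrib]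
    exact Finset.sum_congr rfl fun i _ => by ring
  have i8 : Integrable (fun y => ∑ i, (x i / ‖x‖) * (partialD i F y / ‖x - y‖ ^ 4) +
      4 * ((∑ i, (x i - y i) * (x i / ‖x‖ - y i / ‖y‖)) / ‖x - y‖ ^ 6 * F y)) :=
    i5.add (i6.const_mul 4)
  simp only [key]
  rw [integral_add i7 i8, hz, zero_add, integral_add i5 (i6.const_mul 4),
    integral_const_mul, integral_finsetSum _ fun i _ => (i4 i).const_mul (x i / ‖x‖)]
  simp only [integral_const_mul]
  ring

end hartree

section hartree
variable {d : ℕ} {F f : Ed d → ℝ}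

lemma ae_ne_zero (hd : 0 < d) : ∀ᵐ x : Ed d, x ≠ 0 := by
  have : Nonempty (Fin d) := ⟨⟨0, hd⟩⟩
  have : Nontrivial (Ed d) := inferInstance
  simp [ae_iff]

lemma sum_sub_mul_normalize_sub {x y : Ed d} (hx : x ≠ 0) (hy : y ≠ 0) :
    ∑ i, (x i - y i) * (x i / ‖x‖ - y i / ‖y‖) =
      (‖x‖ * ‖y‖ - ⟪x, y⟫) * (‖x‖⁻¹ + ‖y‖⁻¹) := by
  have hx' : ‖x‖ ≠ 0 := by simpa using hx
  have hy' : ‖y‖ ≠ 0 := by simpa using hy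
  have h1 : ∑ i, (x i - y i) * (x i / ‖x‖ - y i / ‖y‖) =
      ‖x‖⁻¹ * ∑ i, x i ^ 2 + ‖y‖⁻¹ * ∑ i, y i ^ 2 - (‖x‖⁻¹ + ‖y‖⁻¹) * ∑ i, x i * y i := by
    simp only [Finset.mul_sum, ← Finset.sum_add_distrib, ← Finset.sum_sub_distrib]
    exact Finset.sum_congr rfl fun i _ => by ring
  have h2 : ⟪x, y⟫ = ∑ i, x i * y i := by
    rw [PiLp.inner_apply]
    exact Finset.sum_congr rfl fun i _ => by simp [mul_comm]
  rw [h1, sum_sq_apply, sum_sq_apply, h2]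
  field_simp
  ring

/-- The virial identity for the potential `|·|⁻⁴ ∗ F`. -/
lemma integral_potential_mul_radial (hd : 5 ≤ d) (hF : ContDiff ℝ 1 F)
    (hFs : HasCompactSupport F) :
    ∫ x, (∫ y, F y / ‖x - y‖ ^ 4) *
        (∑ i, partialD i F x * (x i / ‖x‖) + ((d : ℝ) - 1) * F x / ‖x‖) =
      2 * ∫ x, ∫ y, (‖x‖ * ‖y‖ - ⟪x, y⟫) * (‖x‖⁻¹ + ‖y‖⁻¹) / ‖x - y‖ ^ 6 * F x * F y := by
  obtain ⟨hV, hV'⟩ := contDiff_potential hd hF hFs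
  set V : Ed d → ℝ := fun x => ∫ y, F y / ‖x - y‖ ^ 4 with hVdef
  set m : Ed d → ℝ := fun x =>
    ∑ i, partialD i F x * (x i / ‖x‖) + ((d : ℝ) - 1) * F x / ‖x‖ with hm
  have hmi : Integrable m := by
    simpa using integrable_mul_radial hd (G := fun _ => 1) continuous_const hF hFs ((d : ℝ) - 1)
  have hms : HasCompactSupport m := by
    refine HasCompactSupport.intro hFs fun x hx => ?_
    have h1 : ∀ i, partialD i F x = 0 := fun i =>
      image_eq_zero_of_notMem_tsupport fun h => hx (tsupport_fderiv_apply_subset ℝ _ h)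
    simp [hm, h1, image_eq_zero_of_notMem_tsupport hx]
  have p1 : Integrable (fun x => V x * m x) :=
    integrable_mul_radial hd hV.continuous hF hFs ((d : ℝ) - 1)
  have hpt : ∀ x, ∑ i, partialD i (fun y => F y * V y) x * (x i / ‖x‖) +
      ((d : ℝ) - 1) * (F x * V x) / ‖x‖ =
      V x * m x + F x * ∑ i, (x i / ‖x‖) * ∫ y, partialD i F y / ‖x - y‖ ^ 4 := by
    intro x
    have e : ∀ i, partialD i (fun y => F y * V y) x =
        partialD i F x * V x + F x * ∫ y, partialD i F y / ‖x - y‖ ^ 4 := by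
      intro i
      rw [partialD_mul (hF.differentiable one_ne_zero x) (hV.differentiable one_ne_zero x), hV']
    simp only [e, hm, mul_add, Finset.mul_sum, add_mul, Finset.sum_add_distrib]
    rw [add_right_comm]
    congr 1
    · congr 1
      · exact Finset.sum_congr rfl fun i _ => by ring
      · ring
    · exact Finset.sum_congr rfl fun i _ => by ring
  have p2 : Integrable (fun x => F x * ∑ i, (x i / ‖x‖) * ∫ y, partialD i F y / ‖x - y‖ ^ 4) := by
    have := integrable_mul_radial hd (G := fun _ => 1) continuous_const (hF.mul hV)
      (hFs.mul_right (f' := V)) ((d : ℝ) - 1)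
    refine (this.sub p1).congr (Filter.Eventually.of_forall fun x => ?_)
    simp only [Pi.sub_apply, one_mul, hpt]
    ring
  have q1 : (∫ x, V x * m x) +
      ∫ x, F x * ∑ i, (x i / ‖x‖) * ∫ y, partialD i F y / ‖x - y‖ ^ 4 = 0 := by
    rw [← integral_add p1 p2, ← integral_radial_div hd (hF.mul hV) (hFs.mul_right (f' := V))]
    simp only [hpt]
  have p3' := integrable_prod_potential hd hF.continuous hFs hmi hms
  have p3 : Integrable (fun x => F x * ∫ y, m y / ‖x - y‖ ^ 4) := by
    refine p3'.integral_prod_left.congr (Filter.Eventually.of_forall fun x => ?_)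
    simp only [← integral_const_mul, mul_div_assoc]
  have q2 : ∫ x, V x * m x = ∫ x, F x * ∫ y, m y / ‖x - y‖ ^ 4 := by
    have e1 : ∀ x, F x * ∫ y, m y / ‖x - y‖ ^ 4 = ∫ y, F x * m y / ‖x - y‖ ^ 4 := fun x => by
      simp only [← integral_const_mul, mul_div_assoc]
    simp only [e1]
    rw [integral_integral_swap p3']
    refine integral_congr_ae (Filter.Eventually.of_forall fun y => ?_)
    simp only [hVdef, ← integral_mul_const]
    refine integral_congr_ae (Filter.Eventually.of_forall fun x => ?_)
    simp only [norm_sub_rev y x]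
    ring
  have hnorm : Integrable (fun y => F y * ‖y‖⁻¹) :=
    integrable_mul_of_le_inv_norm_pow (k := 1) (C := 1) (by omega) hF.continuous hFs
      (by fun_prop) (fun x => by simp)
  have p4 := integrable_prod_potential hd hF.continuous hFs hnorm (hFs.mul_right)
  have hae := ae_ne_zero (d := d) (by omega)
  have q3 : ∀ᵐ x : Ed d, (F x * ∫ y, m y / ‖x - y‖ ^ 4) -
      F x * ∑ i, (x i / ‖x‖) * ∫ y, partialD i F y / ‖x - y‖ ^ 4 =
      4 * ∫ y, (‖x‖ * ‖y‖ - ⟪x, y⟫) * (‖x‖⁻¹ + ‖y‖⁻¹) / ‖x - y‖ ^ 6 * F x * F y := by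
    filter_upwards [hae, p4.prod_right_ae] with x hx hx2
    by_cases h0 : F x = 0
    · simp [h0]
    have hFx : Integrable (fun y => F y * ‖y‖⁻¹ / ‖x - y‖ ^ 4) := by
      refine (hx2.const_mul (F x)⁻¹).congr (Filter.Eventually.of_forall fun y => ?_)
      simp only
      field_simp
    rw [← mul_sub, integral_radial_potential_sub hd hF hFs hx hFx, mul_left_comm,
      ← integral_const_mul]
    congr 1
    refine integral_congr_ae ?_
    filter_upwards [hae] with y hy
    rw [sum_sub_mul_normalize_sub hx hy]
    ring
  have q4 := integral_congr_ae q3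
  rw [integral_sub p3 p2, integral_const_mul] at q4
  linarith

/-- The Morawetz identity for the Hartree nonlinearity. -/
lemma integral_hartreePot_mul_radialMult (hd : 5 ≤ d) (hf : ContDiff ℝ 1 f)
    (hfs : HasCompactSupport f) :
    Continuous (hartreePot f) ∧ ∫ x, hartreePot f x * f x * radialMult f x =
      ∫ x, ∫ y, (‖x‖ * ‖y‖ - ⟪x, y⟫) * (‖x‖⁻¹ + ‖y‖⁻¹) / ‖x - y‖ ^ 6 * f x ^ 2 * f y ^ 2 := by
  have hf2 : ContDiff ℝ 1 (fun x => f x ^ 2) := hf.pow 2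
  have hfs2 : HasCompactSupport (fun x => f x ^ 2) := by
    simp only [pow_two]
    exact hfs.mul_left (f := f)
  refine ⟨(contDiff_potential hd hf2 hfs2).1.continuous, ?_⟩
  have h := integral_potential_mul_radial hd hf2 hfs2
  have e : ∀ x, hartreePot f x * f x * radialMult f x = 2⁻¹ * ((∫ y, f y ^ 2 / ‖x - y‖ ^ 4) *
      (∑ i, partialD i (fun x => f x ^ 2) x * (x i / ‖x‖) +
        ((d : ℝ) - 1) * f x ^ 2 / ‖x‖)) := by
    intro x
    have hx := hf.differentiable one_ne_zero x
    simp only [pow_two (f _), partialD_mul hx hx, radialMult, hartreePot, mul_add, Finset.mul_sum]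
    congr 1
    · exact Finset.sum_congr rfl fun i _ => by ring
    · ring
  simp only [e]
  rw [integral_const_mul, h]
  ring

end hartree

section spacetime
variable {d : ℕ} {a b R : ℝ} {w : ℝ → Ed d → ℝ}

lemma hasDerivAt_timeDeriv (hw : ContDiff ℝ 1 (fun p : ℝ × Ed d => w p.1 p.2)) (t : ℝ) (x : Ed d) :
    HasDerivAt (fun s => w s x) (timeDeriv w t x) t := by
  have h : DifferentiableAt ℝ (fun s => w s x) t := by
    have : ContDiff ℝ 1 (fun s => w s x) := hw.comp (contDiff_id.prodMk contDiff_const)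
    exact this.differentiable one_ne_zero t
  exact h.hasDerivAt

lemma timeDeriv_eq_fderiv (hw : ContDiff ℝ 1 (fun p : ℝ × Ed d => w p.1 p.2)) (t : ℝ) (x : Ed d) :
    timeDeriv w t x = fderiv ℝ (fun p : ℝ × Ed d => w p.1 p.2) (t, x) (1, 0) := by
  have h := (hw.differentiable one_ne_zero (t, x)).hasFDerivAt.comp_hasDerivAt t
    ((hasDerivAt_id t).prodMk (hasDerivAt_const t x))
  exact h.deriv

lemma partialD_eq_fderiv (hw : ContDiff ℝ 1 (fun p : ℝ × Ed d => w p.1 p.2)) (i : Fin d) (t : ℝ)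
    (x : Ed d) : partialD i (w t) x =
      fderiv ℝ (fun p : ℝ × Ed d => w p.1 p.2) (t, x) (0, EuclideanSpace.single i 1) := by
  have h := (hw.differentiable one_ne_zero (t, x)).hasFDerivAt.comp x
    ((hasFDerivAt_const t x).prodMk (hasFDerivAt_id x))
  have h' : fderiv ℝ (w t) x = _ := h.fderiv
  rw [partialD, h']
  simp

lemma contDiff_slice {n : WithTop ℕ∞} (hw : ContDiff ℝ n (fun p : ℝ × Ed d => w p.1 p.2)) (t : ℝ) :
    ContDiff ℝ n (w t) :=
  hw.comp (contDiff_const.prodMk contDiff_id)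

lemma contDiff_timeDeriv {n : WithTop ℕ∞}
    (hw : ContDiff ℝ (n + 1) (fun p : ℝ × Ed d => w p.1 p.2)) :
    ContDiff ℝ n (fun p : ℝ × Ed d => timeDeriv w p.1 p.2) := by
  have h1 : ContDiff ℝ 1 (fun p : ℝ × Ed d => w p.1 p.2) := hw.of_le le_add_self
  simp only [timeDeriv_eq_fderiv h1]
  exact (hw.fderiv_right le_rfl).clm_apply contDiff_const

lemma contDiff_partialD_slice {n : WithTop ℕ∞}
    (hw : ContDiff ℝ (n + 1) (fun p : ℝ × Ed d => w p.1 p.2)) (i : Fin d) :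
    ContDiff ℝ n (fun p : ℝ × Ed d => partialD i (w p.1) p.2) := by
  have h1 : ContDiff ℝ 1 (fun p : ℝ × Ed d => w p.1 p.2) := hw.of_le le_add_self
  simp only [partialD_eq_fderiv h1]
  exact (hw.fderiv_right le_rfl).clm_apply contDiff_const

lemma timeDeriv_partialD (hw : ContDiff ℝ 2 (fun p : ℝ × Ed d => w p.1 p.2)) (i : Fin d) (t : ℝ)
    (x : Ed d) :
    timeDeriv (fun t x => partialD i (w t) x) t x = partialD i (timeDeriv w t) x := by
  have h1 : ContDiff ℝ 1 (fun p : ℝ × Ed d => w p.1 p.2) := hw.of_le one_le_two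
  have h2 : ContDiff ℝ 1 (fderiv ℝ (fun p : ℝ × Ed d => w p.1 p.2)) := hw.fderiv_right le_rfl
  rw [timeDeriv_eq_fderiv (contDiff_partialD_slice (n := 1) hw i),
    partialD_eq_fderiv (contDiff_timeDeriv (n := 1) hw)]
  simp only [timeDeriv_eq_fderiv h1, partialD_eq_fderiv h1]
  have hd := h2.differentiable one_ne_zero (t, x)
  have e : ∀ v v' : ℝ × Ed d,
      fderiv ℝ (fun p : ℝ × Ed d => fderiv ℝ (fun p : ℝ × Ed d => w p.1 p.2) p v) (t, x) v' =
      fderiv ℝ (fderiv ℝ (fun p : ℝ × Ed d => w p.1 p.2)) (t, x) v' v := by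
    intro v v'
    rw [fderiv_clm_apply hd (differentiableAt_const v)]
    simp
  have hs : IsSymmSndFDerivAt ℝ (fun p : ℝ × Ed d => w p.1 p.2) (t, x) :=
    hw.contDiffAt.isSymmSndFDerivAt (by simp)
  exact (e _ _).trans ((hs.eq _ _).trans (e _ _).symm)

/-- The time derivative of a function vanishing on `(a, b) × {R < |x|}` vanishes there. -/
lemma timeDeriv_eq_zero (hw : ∀ t ∈ Set.Ioo a b, ∀ x : Ed d, R < ‖x‖ → w t x = 0) :
    ∀ t ∈ Set.Ioo a b, ∀ x : Ed d, R < ‖x‖ → timeDeriv w t x = 0 := by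
  intro t ht x hx
  have : (fun s => w s x) =ᶠ[nhds t] fun _ => 0 := by
    filter_upwards [isOpen_Ioo.mem_nhds ht] with s hs using hw s hs x hx
  rw [timeDeriv, this.deriv_eq]
  simp

/-- The spatial derivatives of a function vanishing on `(a, b) × {R < |x|}` vanish there. -/
lemma partialD_eq_zero (hw : ∀ t ∈ Set.Ioo a b, ∀ x : Ed d, R < ‖x‖ → w t x = 0) (i : Fin d) :
    ∀ t ∈ Set.Ioo a b, ∀ x : Ed d, R < ‖x‖ → partialD i (w t) x = 0 := by
  intro t ht x hx
  have : w t =ᶠ[nhds x] fun _ => 0 := by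
    filter_upwards [(isOpen_lt continuous_const continuous_norm).mem_nhds hx] with y hy
      using hw t ht y hy
  rw [partialD, this.fderiv_eq]
  simp

lemma hasCompactSupport_of_norm {f : Ed d → ℝ} (hf : ∀ x, R < ‖x‖ → f x = 0) :
    HasCompactSupport f :=
  HasCompactSupport.intro (isCompact_closedBall 0 R) fun x hx => hf x (by simpa using hx)

/-- Integrability on a slab of a continuous function of bounded spatial support times a
function with an integrable singularity at the spatial origin. -/
lemma integrable_prod_mul_of_le_inv_norm_pow {k : ℕ} (hk : k < d) {G : ℝ × Ed d → ℝ}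
    (hG : Continuous G) (hG0 : ∀ t ∈ Set.Ioo a b, ∀ x : Ed d, R < ‖x‖ → G (t, x) = 0)
    {h : Ed d → ℝ} (hh : Measurable h) {C : ℝ} (hb : ∀ x, |h x| ≤ C * (‖x‖ ^ k)⁻¹) :
    Integrable (fun p : ℝ × Ed d => G p * h p.2)
      ((volume.restrict (Set.Ioo a b)).prod volume) := by
  obtain ⟨M, hM⟩ := (isCompact_Icc (a := a) (b := b)).prod (isCompact_closedBall (0 : Ed d) R)
    |>.exists_bound_of_continuousOn hG.continuousOn
  have hg := ((integrableOn_inv_norm_pow hk (R + 1)).integrable_indicator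
    measurableSet_ball).const_mul C |>.const_mul |M| |>.comp_snd (volume.restrict (Set.Ioo a b))
  refine hg.mono' (hG.measurable.mul (hh.comp measurable_snd)).aestronglyMeasurable ?_
  have hfst : ∀ᵐ p : ℝ × Ed d ∂(volume.restrict (Set.Ioo a b)).prod volume,
      p.1 ∈ Set.Ioo a b :=
    Measure.quasiMeasurePreserving_fst.ae (ae_restrict_mem measurableSet_Ioo)
  filter_upwards [hfst] with p hp
  rcases lt_or_ge R ‖p.2‖ with hx | hx
  · rw [hG0 p.1 hp p.2 hx]
    by_cases hx' : p.2 ∈ Metric.ball (0 : Ed d) (R + 1)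
    · rw [Set.indicator_of_mem hx']
      simpa using mul_nonneg (abs_nonneg M) ((abs_nonneg _).trans (hb p.2))
    · simp [Set.indicator_of_notMem hx']
  · have h1 : p.2 ∈ Metric.ball (0 : Ed d) (R + 1) := by
      simp only [mem_ball_zero_iff]
      linarith
    rw [Set.indicator_of_mem h1, norm_mul]
    have h2 : ‖G p‖ ≤ |M| := (hM p ⟨⟨hp.1.le, hp.2.le⟩, by simpa using hx⟩).trans (le_abs_self M)
    exact mul_le_mul h2 (hb p.2) (norm_nonneg _) ((norm_nonneg _).trans h2)

end spacetime

section spacetime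
variable {d : ℕ} {a b R : ℝ} {w : ℝ → Ed d → ℝ}

lemma hasDerivAt_radialMult (hw : ContDiff ℝ 2 (fun p : ℝ × Ed d => w p.1 p.2)) (t : ℝ) (x : Ed d) :
    HasDerivAt (fun s => radialMult (w s) x) (radialMult (timeDeriv w t) x) t := by
  have h1 : ∀ i, HasDerivAt (fun s => partialD i (w s) x) (partialD i (timeDeriv w t) x) t := by
    intro i
    rw [← timeDeriv_partialD hw]
    exact hasDerivAt_timeDeriv (w := fun s y => partialD i (w s) y)
      (contDiff_partialD_slice (n := 1) hw i) t x
  have h2 := hasDerivAt_timeDeriv (hw.of_le one_le_two) t x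
  exact (HasDerivAt.fun_sum fun i _ => (h1 i).mul_const (x i / ‖x‖)).add
    ((h2.const_mul _).div_const _)

lemma integrable_prod_mul_radialMult (hd : 5 ≤ d) {G : ℝ × Ed d → ℝ} (hG : Continuous G)
    (hw : ContDiff ℝ 1 (fun p : ℝ × Ed d => w p.1 p.2))
    (hw0 : ∀ t ∈ Set.Ioo a b, ∀ x : Ed d, R < ‖x‖ → w t x = 0) :
    Integrable (fun p : ℝ × Ed d => G p * radialMult (w p.1) p.2)
      ((volume.restrict (Set.Ioo a b)).prod volume) := by
  have h1 := fun i => integrable_prod_mul_of_le_inv_norm_pow (a := a) (b := b) (R := R) (k := 0)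
    (C := 1) (h := fun x : Ed d => x i / ‖x‖) (by omega)
    (hG.mul (contDiff_partialD_slice (n := 0) hw i).continuous)
    (fun t ht x hx => by simp [partialD_eq_zero hw0 i t ht x hx]) (by fun_prop)
    (fun x => by simpa using abs_apply_div_norm_le x i)
  have h2 := integrable_prod_mul_of_le_inv_norm_pow (a := a) (b := b) (R := R) (k := 1)
    (C := 1) (h := fun x : Ed d => ‖x‖⁻¹) (by omega) (hG.mul hw.continuous)
    (fun t ht x hx => by simp [hw0 t ht x hx]) (by fun_prop) (fun x => by simp)
  refine ((integrable_finsetSum Finset.univ fun i _ => h1 i).add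
    (h2.const_mul (((d : ℝ) - 1) / 2))).congr (Filter.Eventually.of_forall fun p => ?_)
  simp only [Pi.add_apply, Pi.mul_apply, radialMult, mul_add, Finset.mul_sum]
  congr 1
  · exact Finset.sum_congr rfl fun i _ => by ring
  · ring

lemma integrable_prod_angular (hd : 5 ≤ d) (hw : ContDiff ℝ 1 (fun p : ℝ × Ed d => w p.1 p.2))
    (hw0 : ∀ t ∈ Set.Ioo a b, ∀ x : Ed d, R < ‖x‖ → w t x = 0) (c : ℝ) :
    Integrable (fun p : ℝ × Ed d => ‖angularGrad (w p.1) p.2‖ ^ 2 / ‖p.2‖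
      + c * w p.1 p.2 ^ 2 / ‖p.2‖ ^ 3) ((volume.restrict (Set.Ioo a b)).prod volume) := by
  have hc := fun i => (contDiff_partialD_slice (n := 0) hw i).continuous
  have h1 := fun i => integrable_prod_mul_of_le_inv_norm_pow (a := a) (b := b) (R := R) (k := 1)
    (C := 1) (h := fun x : Ed d => ‖x‖⁻¹) (by omega) ((hc i).pow 2)
    (fun t ht x hx => by simp [partialD_eq_zero hw0 i t ht x hx]) (by fun_prop) (fun x => by simp)
  have h2 := fun i j => integrable_prod_mul_of_le_inv_norm_pow (a := a) (b := b) (R := R) (k := 1)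
    (C := 1) (h := fun x : Ed d => x i * x j / ‖x‖ ^ 3) (by omega) ((hc i).mul (hc j))
    (fun t ht x hx => by simp [partialD_eq_zero hw0 i t ht x hx]) (by fun_prop)
    (fun x => by simpa using abs_apply_mul_div_le x i j)
  have h3 := integrable_prod_mul_of_le_inv_norm_pow (a := a) (b := b) (R := R) (k := 3)
    (C := 1) (h := fun x : Ed d => (‖x‖ ^ 3)⁻¹) (by omega) (hw.continuous.pow 2)
    (fun t ht x hx => by simp [hw0 t ht x hx]) (by fun_prop) (fun x => by simp)
  refine (((integrable_finsetSum Finset.univ fun i _ => h1 i).sub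
    (integrable_finsetSum Finset.univ fun i _ => integrable_finsetSum Finset.univ
      fun j _ => h2 i j)).add (h3.const_mul c)).congr ?_
  have hsnd : ∀ᵐ p : ℝ × Ed d ∂(volume.restrict (Set.Ioo a b)).prod volume, p.2 ≠ 0 :=
    Measure.quasiMeasurePreserving_snd.ae (ae_ne_zero (by omega))
  filter_upwards [hsnd] with p hp
  rw [sq_norm_angularGrad hp, pow_two (∑ i, partialD i (w p.1) p.2 * (p.2 i / ‖p.2‖)),
    Finset.sum_mul_sum]
  simp only [Pi.add_apply, Pi.sub_apply, Pi.mul_apply, Pi.pow_apply, sub_div, Finset.sum_div]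
  congr 1
  · congr 1
    refine Finset.sum_congr rfl fun i _ => Finset.sum_congr rfl fun j _ => ?_
    field_simp
  · ring

end spacetime

section waveHartree
variable {d : ℕ} {a b R : ℝ} {u : ℝ → Ed d → ℝ}

/-- The Morawetz identity at a fixed time, in differential form. -/
lemma IsWaveHartreeSol.integral_deriv_morawetz (hd : 5 ≤ d) {I : Set ℝ} (hu : IsWaveHartreeSol I u)
    {t : ℝ} (ht : t ∈ I) (h0 : HasCompactSupport (u t)) (h1 : HasCompactSupport (timeDeriv u t)) :
    ∫ x, (timeDeriv (timeDeriv u) t x * radialMult (u t) x +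
        timeDeriv u t x * radialMult (timeDeriv u t) x) =
      -(∫ x, (‖angularGrad (u t) x‖ ^ 2 / ‖x‖
        + (((d : ℝ) - 1) * ((d : ℝ) - 3) / 4) * u t x ^ 2 / ‖x‖ ^ 3)) -
      ∫ x, ∫ y, (‖x‖ * ‖y‖ - ⟪x, y⟫) * (‖x‖⁻¹ + ‖y‖⁻¹) / ‖x - y‖ ^ 6
        * (u t x) ^ 2 * (u t y) ^ 2 := by
  obtain ⟨hu2, hpde⟩ := hu
  have c2 : ContDiff ℝ 2 (u t) := contDiff_slice hu2 t
  have c1 : ContDiff ℝ 1 (u t) := c2.of_le one_le_two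
  have k1 : ContDiff ℝ 1 (timeDeriv u t) :=
    contDiff_slice (contDiff_timeDeriv (n := 1) hu2) t
  obtain ⟨hVc, hV⟩ := integral_hartreePot_mul_radialMult hd c1 h0
  obtain ⟨-, hL⟩ := integral_laplacian_mul_radialMult hd c2 h0
  have e : ∀ x, timeDeriv (timeDeriv u) t x =
      ∑ i, partialD i (partialD i (u t)) x - hartreePot (u t) x * u t x := by
    intro x
    have h := hpde t ht x
    rw [spaceLaplacian_eq c2, iteratedDeriv_succ, iteratedDeriv_one] at h
    have : timeDeriv (timeDeriv u) t x = deriv (deriv fun s => u s x) t := rfl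
    rw [this]
    linarith
  have i1 : Integrable (fun x => (∑ i, partialD i (partialD i (u t)) x) * radialMult (u t) x) :=
    integrable_mul_radialMult hd (continuous_finsetSum _ fun i _ =>
      (c2.partialD (n := 1) i).continuous_partialD i) c1 h0
  have i2 : Integrable (fun x => hartreePot (u t) x * u t x * radialMult (u t) x) :=
    integrable_mul_radialMult hd (hVc.mul c1.continuous) c1 h0
  have i3 : Integrable (fun x => timeDeriv u t x * radialMult (timeDeriv u t) x) :=
    integrable_mul_radialMult hd k1.continuous k1 h1
  have i4 : Integrable (fun x => (∑ i, partialD i (partialD i (u t)) x) * radialMult (u t) x -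
      hartreePot (u t) x * u t x * radialMult (u t) x) := i1.sub i2
  rw [← hL, ← hV, ← integral_sub i1 i2]
  simp only [e, sub_mul]
  rw [integral_add i4 i3, integral_mul_radialMult_self hd k1 h1, add_zero]

end waveHartree

/-- The Morawetz identity for compactly supported classical solutions of the
wave-Hartree equation on `[a,b] × ℝ^d`, `d ≥ 5`. -/
theorem stmt2 (d : ℕ) (hd : 5 ≤ d) (a b : ℝ) (hab : a ≤ b)
    (u : ℝ → Ed d → ℝ) (hu : IsWaveHartreeSol (Set.Icc a b) u)
    (hsupp : ∃ R > 0, ∀ t ∈ Set.Icc a b, ∀ x : Ed d, R ≤ ‖x‖ → u t x = 0) :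
    (∫ t in Set.Icc a b, ∫ x : Ed d,
        (‖angularGrad (u t) x‖ ^ 2 / ‖x‖
          + (((d : ℝ) - 1) * ((d : ℝ) - 3) / 4) * (u t x) ^ 2 / ‖x‖ ^ 3))
      + (∫ t in Set.Icc a b, ∫ x : Ed d, ∫ y : Ed d,
          (‖x‖ * ‖y‖ - ⟪x, y⟫) * (‖x‖⁻¹ + ‖y‖⁻¹) / ‖x - y‖ ^ 6
            * (u t x) ^ 2 * (u t y) ^ 2)
      = (∫ x : Ed d, timeDeriv u a x * morawetzMult u a x)
        - ∫ x : Ed d, timeDeriv u b x * morawetzMult u b x := by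
  obtain ⟨hu2, -⟩ := id hu
  obtain ⟨R, -, hR⟩ := hsupp
  have hu1 : ContDiff ℝ 1 (fun p : ℝ × Ed d => u p.1 p.2) := hu2.of_le one_le_two
  have hv1 : ContDiff ℝ 1 (fun p : ℝ × Ed d => timeDeriv u p.1 p.2) :=
    contDiff_timeDeriv (n := 1) hu2
  have hutt : Continuous (fun p : ℝ × Ed d => timeDeriv (timeDeriv u) p.1 p.2) :=
    (contDiff_timeDeriv (n := 0) hv1).continuous
  have z0 : ∀ t ∈ Set.Ioo a b, ∀ x : Ed d, R < ‖x‖ → u t x = 0 := fun t ht x hx =>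
    hR t (Set.Ioo_subset_Icc_self ht) x hx.le
  have z1 := timeDeriv_eq_zero z0
  set H : ℝ → Ed d → ℝ := fun t x => timeDeriv (timeDeriv u) t x * radialMult (u t) x +
    timeDeriv u t x * radialMult (timeDeriv u t) x with hH
  have hHi : Integrable (fun p : ℝ × Ed d => H p.1 p.2)
      ((volume.restrict (Set.Ioo a b)).prod volume) :=
    (integrable_prod_mul_radialMult hd hutt hu1 z0).add
      (integrable_prod_mul_radialMult hd hv1.continuous hv1 z1)
  have hAi := (integrable_prod_angular hd hu1 z0
    (((d : ℝ) - 1) * ((d : ℝ) - 3) / 4)).integral_prod_left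
  have hDi := hHi.integral_prod_left
  have hfix : ∀ t ∈ Set.Ioo a b, _ := fun t ht =>
    hu.integral_deriv_morawetz hd (Set.Ioo_subset_Icc_self ht)
      (hasCompactSupport_of_norm (z0 t ht)) (hasCompactSupport_of_norm (z1 t ht))
  have hB : ∀ t ∈ Set.Ioo a b, ∫ x : Ed d, ∫ y : Ed d,
          (‖x‖ * ‖y‖ - ⟪x, y⟫) * (‖x‖⁻¹ + ‖y‖⁻¹) / ‖x - y‖ ^ 6
            * (u t x) ^ 2 * (u t y) ^ 2 =
      -(∫ x, (‖angularGrad (u t) x‖ ^ 2 / ‖x‖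
        + (((d : ℝ) - 1) * ((d : ℝ) - 3) / 4) * u t x ^ 2 / ‖x‖ ^ 3)) - ∫ x, H t x := by
    intro t ht
    rw [hH, hfix t ht]
    ring
  have hftc : ∀ x, ∫ t in Set.Ioo a b, H t x =
      timeDeriv u b x * morawetzMult u b x - timeDeriv u a x * morawetzMult u a x := by
    intro x
    have hd' : ∀ t, HasDerivAt (fun t => timeDeriv u t x * radialMult (u t) x) (H t x) t :=
      fun t => (hasDerivAt_timeDeriv hv1 t x).mul (hasDerivAt_radialMult hu2 t x)
    have hc : Continuous (fun t => H t x) := by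
      have hm : Continuous fun t : ℝ => (t, x) := by fun_prop
      have q1 : Continuous fun t => radialMult (u t) x :=
        continuous_iff_continuousAt.2 fun t => (hasDerivAt_radialMult hu2 t x).continuousAt
      have q2 : Continuous fun t => radialMult (timeDeriv u t) x :=
        (continuous_finsetSum _ fun i _ =>
          ((contDiff_partialD_slice (n := 0) hv1 i).continuous.comp hm).mul_const _).add
        ((continuous_const.mul (hv1.continuous.comp hm)).div_const _)
      exact ((hutt.comp hm).mul q1).add ((hv1.continuous.comp hm).mul q2)
    rw [← integral_Ioc_eq_integral_Ioo, ← intervalIntegral.integral_of_le hab,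
      intervalIntegral.integral_eq_sub_of_hasDerivAt (fun t _ => hd' t)
        (hc.intervalIntegrable _ _)]
    simp only [morawetzMult_eq]
  have hg : ∀ t ∈ Set.Icc a b, Integrable fun x => timeDeriv u t x * morawetzMult u t x := by
    intro t ht
    simp only [morawetzMult_eq]
    exact integrable_mul_radialMult hd (contDiff_slice hv1 t).continuous (contDiff_slice hu1 t)
      (hasCompactSupport_of_norm fun x hx => hR t ht x hx.le)
  have hswap : ∫ t in Set.Ioo a b, ∫ x, H t x = ∫ x, ∫ t in Set.Ioo a b, H t x :=
    integral_integral_swap hHi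
  simp only [hftc] at hswap
  rw [integral_sub (hg b ⟨hab, le_rfl⟩) (hg a ⟨le_rfl, hab⟩)] at hswap
  simp only [integral_Icc_eq_integral_Ioo]
  have hneg := integral_sub hAi.neg hDi
  simp only [Pi.neg_apply, integral_neg, hswap] at hneg
  rw [setIntegral_congr_fun measurableSet_Ioo hB, hneg]
  ring
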